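/- arXiv:2306.11863 — 2 statements merged into one kernel-verified Lean document; each statement's English description precedes it below -/
import Mathlib

section
/- Let q ≥ 2 and n ≥ 1 be integers, and let h be an integer with 1 ≤ h ≤ q^n − 2. The n residues h, qh, q²h, …, q^{n−1}h modulo q^n − 1 are pairwise distinct if and only if there is no divisor d of n with d < n such that (q^n − 1)/(q^d − 1) divides h. -/
/-- Multiplying `h` by `q ^ (i + k)` and by `q ^ i` gives the same residue modulo `q ^ n - 1`
exactly when `q ^ n - 1` divides `(q ^ k - 1) * h`. -/
theorem natCast_pow_add_mul_eq_iff {q n : ℕ} (hq : 1 ≤ q) (hn : n ≠ 0) (h i k : ℕ) :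
    ((q ^ i * h : ℕ) : ZMod (q ^ n - 1)) = ((q ^ (i + k) * h : ℕ) : ZMod (q ^ n - 1)) ↔
      q ^ n - 1 ∣ (q ^ k - 1) * h := by
  have hle : q ^ i * h ≤ q ^ (i + k) * h :=
    Nat.mul_le_mul_right h (Nat.pow_le_pow_right hq (Nat.le_add_right i k))
  have hcop : Nat.Coprime (q ^ n - 1) (q ^ i) := by
    have hself : Nat.Coprime (q ^ n - 1) (q ^ n) :=
      (Nat.coprime_self_sub_left (Nat.one_le_pow n q hq)).mpr (Nat.coprime_one_left _)
    exact ((Nat.coprime_pow_right_iff (Nat.pos_of_ne_zero hn) _ _).mp hself).pow_right i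
  have hsub : q ^ (i + k) * h - q ^ i * h = q ^ i * ((q ^ k - 1) * h) := by
    rw [pow_add, ← Nat.sub_mul, ← mul_assoc, Nat.mul_sub, mul_one]
  rw [ZMod.natCast_eq_natCast_iff, Nat.modEq_iff_dvd' hle, hsub, hcop.dvd_mul_left]

/-- For a positive divisor `d` of `n`, the quotient `(q ^ n - 1) / (q ^ d - 1)` divides `h`
exactly when `q ^ n - 1` divides `(q ^ d - 1) * h`. -/
theorem pow_sub_one_div_dvd_iff {q n d : ℕ} (hq : 2 ≤ q) (hd : d ≠ 0) (hdn : d ∣ n) (h : ℕ) :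
    (q ^ n - 1) / (q ^ d - 1) ∣ h ↔ q ^ n - 1 ∣ (q ^ d - 1) * h := by
  have hpos : 0 < q ^ d - 1 := Nat.sub_pos_of_lt (Nat.one_lt_pow hd hq)
  exact Nat.div_dvd_iff_dvd_mul (Nat.pow_sub_one_dvd_pow_sub_one q hdn) hpos

/-- Let `q ≥ 2` and `n ≥ 1` be integers, and let `h` be an integer with `1 ≤ h ≤ q^n - 2`.
The `n` residues `h, q·h, q²·h, …, q^{n-1}·h` modulo `q^n - 1` are pairwise distinct if and
only if there is no divisor `d` of `n` with `d < n` such that `(q^n - 1)/(q^d - 1)`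
divides `h` (i.e. iff `h` is `q`-primitive). -/
theorem q_primitive_iff_regular (q n h : ℕ) (hq : 2 ≤ q) (hn : 1 ≤ n)
    (h1 : 1 ≤ h) (h2 : h ≤ q ^ n - 2) :
    (Function.Injective fun i : Fin n => ((q ^ (i : ℕ) * h : ℕ) : ZMod (q ^ n - 1))) ↔
      ¬ ∃ d : ℕ, d ∣ n ∧ d < n ∧ ((q ^ n - 1) / (q ^ d - 1)) ∣ h := by
  have hq1 : 1 ≤ q := by omega
  have hn0 : n ≠ 0 := by omega
  constructor
  · rintro hinj ⟨d, hdn, hlt, hdvd⟩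
    have hd : d ≠ 0 := ne_zero_of_dvd_ne_zero hn0 hdn
    rw [pow_sub_one_div_dvd_iff hq hd hdn, ← natCast_pow_add_mul_eq_iff hq1 hn0 h 0 d,
      zero_add] at hdvd
    have heq : (⟨0, hn⟩ : Fin n) = ⟨d, hlt⟩ := hinj hdvd
    exact hd (Fin.mk.inj heq).symm
  · intro hprim
    refine Function.Injective.of_lt_imp_ne fun i j hij heq => hprim ?_
    obtain ⟨k, hk⟩ := Nat.exists_eq_add_of_lt (Fin.lt_def.mp hij)
    rw [hk, add_assoc, natCast_pow_add_mul_eq_iff hq1 hn0] at heq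
    have hlt : (k + 1).gcd n < n :=
      (Nat.gcd_le_left n k.succ_pos).trans_lt (by omega)
    refine ⟨(k + 1).gcd n, Nat.gcd_dvd_right _ _, hlt, ?_⟩
    rw [pow_sub_one_div_dvd_iff hq (Nat.gcd_ne_zero_right hn0) (Nat.gcd_dvd_right _ _),
      ← Nat.pow_sub_one_gcd_pow_sub_one, ← Nat.gcd_mul_right]
    exact Nat.dvd_gcd heq (dvd_mul_right _ _)
end

section
/- Let p be an odd prime, q = p^f, let 𝔽_{q²} ⊆ 𝔽̄_q be the quadratic extension of 𝔽_q and Frob_q(x) = x^q. For any integer d, the number of group homomorphisms χ : 𝔽_{q²}^× → 𝔽̄_q^× such that χ∘Frob_q = χ and the restriction of χ to 𝔽_q^× equals ω^d is 2 if d is even and 0 if d is odd. -/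
open Polynomial in
theorem FiniteField.exists_units_map_eq_of_pow_card_eq {F L : Type*} [Field F] [Fintype F]
    [Field L] [Algebra F L] {x : Lˣ} (hx : x ^ Fintype.card F = x) :
    ∃ u : Fˣ, Units.map (algebraMap F L).toMonoidHom u = x := by
  have key : (∏ a : F, (X - C a)) = X ^ Fintype.card F - X := by
    have hdeg := X_pow_card_sub_X_natDegree_eq F (Fintype.one_lt_card (α := F))
    have hmonic : (X ^ Fintype.card F - X : F[X]).Monic :=
      monic_X_pow_sub (by simpa using Fintype.one_lt_card (α := F))
    have := prod_multiset_X_sub_C_of_monic_of_roots_card_eq hmonic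
      (by rw [hdeg, roots_X_pow_card_sub_X]; rfl)
    rwa [roots_X_pow_card_sub_X] at this
  have hx' : (x : L) ^ Fintype.card F - x = 0 := by
    rw [sub_eq_zero]
    exact_mod_cast hx
  have hprod := congrArg (aeval (x : L)) key
  simp only [map_prod, map_sub, map_pow, aeval_X, aeval_C, hx', Finset.prod_eq_zero_iff,
    Finset.mem_univ, true_and, sub_eq_zero] at hprod
  obtain ⟨a, ha⟩ := hprod
  have ha0 : a ≠ 0 := by
    rintro rfl
    simp at ha
  exact ⟨Units.mk0 a ha0, Units.ext ha.symm⟩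

theorem FiniteField.units_pow_card {F : Type*} [Field F] [Fintype F] (u : Fˣ) :
    u ^ Fintype.card F = u :=
  Units.ext (by simp [FiniteField.pow_card])

theorem FiniteField.card_units_sq_eq_zpow_generator {F : Type*} [Field F] [Fintype F]
    (hodd : Odd (Fintype.card F)) {h : Fˣ} (hh : ∀ u : Fˣ, u ∈ Subgroup.zpowers h) (d : ℤ) :
    Nat.card {u : Fˣ // u ^ 2 = h ^ d} = if Even d then 2 else 0 := by
  split_ifs with hd
  · obtain ⟨k, rfl⟩ := hd
    have hchar : ringChar F ≠ 2 := fun h2 ↦ by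
      have := FiniteField.even_card_of_char_two h2
      have := Nat.odd_iff.mp hodd
      omega
    have hset : {u : Fˣ | u ^ 2 = h ^ (k + k)} = {h ^ k, -h ^ k} := by
      ext u
      rw [Set.mem_ofPred_eq, zpow_add, ← sq, Set.mem_insert_iff, Set.mem_singleton_iff]
      simp only [Units.ext_iff, Units.val_pow_eq_pow_val, Units.val_neg, sq_eq_sq_iff_eq_or_eq_neg]
    have hne : h ^ k ≠ -h ^ k := fun e ↦
      (h ^ k).ne_zero
      ((Ring.eq_self_iff_eq_zero_of_char_ne_two hchar).mp (congrArg Units.val e).symm)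
    exact (congrArg Set.ncard hset).trans (Set.ncard_pair hne)
  · have : IsEmpty {u : Fˣ // u ^ 2 = h ^ d} := by
      refine ⟨fun ⟨u, hu⟩ ↦ hd ?_⟩
      obtain ⟨k, rfl⟩ := Subgroup.mem_zpowers_iff.mp (hh u)
      rw [← zpow_natCast, ← zpow_mul, zpow_eq_zpow_iff_modEq,
        orderOf_eq_card_of_forall_mem_zpowers hh, Nat.card_units, Nat.card_eq_fintype_card] at hu
      have hev : (2 : ℤ) ∣ ((Fintype.card F - 1 : ℕ) : ℤ) := by
        obtain ⟨m, hm⟩ := hodd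
        exact ⟨m, by omega⟩
      have hdvd : (2 : ℤ) ∣ d - k * 2 := hev.trans hu.dvd
      exact even_iff_two_dvd.mpr (by omega)
    exact Nat.card_of_isEmpty

theorem FiniteField.exists_units_generators {F K : Type*} [Field F] [Fintype F]
    [Field K] [Fintype K] [Algebra F K] (hK : Fintype.card K = Fintype.card F ^ 2) :
    ∃ (h : Fˣ) (g : Kˣ), (∀ u, u ∈ Subgroup.zpowers h) ∧ (∀ x, x ∈ Subgroup.zpowers g) ∧
      Units.map (algebraMap F K).toMonoidHom h = g ^ (Fintype.card F + 1) := by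
  have hpos : 0 < Fintype.card F := Fintype.card_pos
  obtain ⟨g, hg⟩ := IsCyclic.exists_generator (α := Kˣ)
  obtain ⟨h, hh⟩ := exists_units_map_eq_of_pow_card_eq (F := F)
    (x := g ^ (Fintype.card F + 1)) (by
      rw [← pow_mul, add_mul, one_mul, ← sq, ← hK, pow_add, units_pow_card, pow_succ'])
  have hord : orderOf g = (Fintype.card F + 1) * (Fintype.card F - 1) := by
    rw [orderOf_eq_card_of_forall_mem_zpowers hg, Nat.card_units, Nat.card_eq_fintype_card, hK,
      ← Nat.sq_sub_sq, one_pow]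
  have hordh : orderOf h = Nat.card Fˣ := by
    rw [← orderOf_injective _ (Units.map_injective (algebraMap F K).injective) h]
    erw [hh]
    rw [orderOf_pow_of_dvd (by omega) (hord ▸ dvd_mul_right _ _), hord,
      Nat.mul_div_cancel_left _ (by omega), Nat.card_units, Nat.card_eq_fintype_card]
  refine ⟨h, g, fun u ↦ ?_, hg, hh⟩
  rw [Subgroup.eq_top_of_card_eq (Subgroup.zpowers h) (by rw [Nat.card_zpowers, hordh])]
  trivial


/-- Let `p` be an odd prime, `q = p ^ f`, `K = 𝔽_{q²}` the quadratic extension of `F = 𝔽_q`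
inside `Ω = 𝔽̄_q`, and `Frob_q (x) = x ^ q`. For any integer `d`, the number of group
homomorphisms `χ : K^× → Ω^×` such that `χ ∘ Frob_q = χ` and the restriction of `χ` to
`F^×` equals `ω ^ d` is `2` if `d` is even and `0` if `d` is odd. -/
theorem frobenius_fixed_count_with_det (p f q : ℕ) (hp : p.Prime) (hodd : Odd p)
    (hf : 0 < f) (hq : q = p ^ f)
    (F K Ω : Type) [Field F] [Fintype F] (hF : Fintype.card F = q)
    [Field K] [Fintype K] (hK : Fintype.card K = q ^ 2)
    [Field Ω] [IsAlgClosed Ω] [Algebra F K] [Algebra K Ω] [Algebra F Ω]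
    [IsScalarTower F K Ω] (d : ℤ) :
    Nat.card {χ : Kˣ →* Ωˣ //
        χ.comp (powMonoidHom q) = χ ∧
        χ.comp (Units.map (algebraMap F K).toMonoidHom) =
          (Units.map (algebraMap F Ω).toMonoidHom) ^ d} =
      if Even d then 2 else 0 := by
  subst hF
  obtain ⟨h, g, hh, hg, hgh⟩ := FiniteField.exists_units_generators (F := F) hK
  have hι : Function.Injective (Units.map (algebraMap F Ω).toMonoidHom) :=
    Units.map_injective (algebraMap F Ω).injective
  have hdvd (u : Fˣ) : orderOf u ∣ orderOf g := by
    refine (orderOf_dvd_natCard u).trans ?_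
    rw [orderOf_eq_card_of_forall_mem_zpowers hg, Nat.card_units, Nat.card_units,
      Nat.card_eq_fintype_card, Nat.card_eq_fintype_card, hK]
    simpa using Nat.sub_dvd_pow_sub_pow (Fintype.card F) 1 2
  rw [← FiniteField.card_units_sq_eq_zpow_generator (hq ▸ hodd.pow) hh d]
  have hfrob (u : Fˣ) : ((Units.map (algebraMap F Ω).toMonoidHom).comp
      (monoidHomOfForallMemZpowers hg (hdvd u))).comp (powMonoidHom (Fintype.card F)) =
      (Units.map (algebraMap F Ω).toMonoidHom).comp (monoidHomOfForallMemZpowers hg (hdvd u)) := by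
    rw [MonoidHom.eq_iff_eq_on_generator hg, MonoidHom.comp_apply, powMonoidHom_apply, map_pow,
      MonoidHom.comp_apply, monoidHomOfForallMemZpowers_apply_gen, ← map_pow,
      FiniteField.units_pow_card]
  have hres (u : Fˣ) (hu : u ^ 2 = h ^ d) : ((Units.map (algebraMap F Ω).toMonoidHom).comp
      (monoidHomOfForallMemZpowers hg (hdvd u))).comp (Units.map (algebraMap F K).toMonoidHom) =
      (Units.map (algebraMap F Ω).toMonoidHom) ^ d := by
    rw [MonoidHom.eq_iff_eq_on_generator hh, MonoidHom.comp_apply, hgh, map_pow,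
      MonoidHom.comp_apply, monoidHomOfForallMemZpowers_apply_gen, ← map_pow, pow_succ,
      FiniteField.units_pow_card, ← sq, hu, map_zpow]
    rfl
  refine (Nat.card_congr (Equiv.ofBijective
    (fun u ↦ ⟨_, hfrob u.1, hres u.1 u.2⟩) ⟨fun u v huv ↦ ?_, ?_⟩)).symm
  · have := DFunLike.congr_fun (congrArg Subtype.val huv) g
    simp only [MonoidHom.comp_apply, monoidHomOfForallMemZpowers_apply_gen] at this
    exact Subtype.ext (hι this)
  · rintro ⟨χ, hχ, hχd⟩
    have hfix : χ g ^ Fintype.card F = χ g := by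
      rw [← map_pow]
      exact DFunLike.congr_fun hχ g
    obtain ⟨u, hu⟩ := FiniteField.exists_units_map_eq_of_pow_card_eq hfix
    have hsq : u ^ 2 = h ^ d := by
      apply hι
      have hgen := DFunLike.congr_fun hχd h
      rw [MonoidHom.comp_apply, hgh, map_pow, pow_succ, hfix, ← sq, ← hu, ← map_pow] at hgen
      rw [hgen, map_zpow]
      rfl
    refine ⟨⟨u, hsq⟩, Subtype.ext ?_⟩
    rw [MonoidHom.eq_iff_eq_on_generator hg, MonoidHom.comp_apply,
      monoidHomOfForallMemZpowers_apply_gen, hu]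
end
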